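/- arXiv:2410.05493 — 2 statements merged into one kernel-verified Lean document; each statement's English description precedes it below -/
import Mathlib

section
/- The CTW mixture weights form a probability vector: ω_{n,l} > 0 for every 0 ≤ l ≤ D and Σ_{l=0}^{D} ω_{n,l} = 1. -/
open scoped Classical

noncomputable section

variable {𝒜 : Type*}

/-- The finset of all strings over `𝒜` of length at most `D`. -/
def stringsLe (𝒜 : Type*) [Fintype 𝒜] (D : ℕ) : Finset (List 𝒜) :=
  Set.Finite.toFinset (List.finite_length_le 𝒜 D)

/-- A context tree of maximum depth `D`, identified with its leaf set: every leaf has length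
at most `D`, no leaf is a (proper) suffix of another, and every string of length `D` has
exactly one suffix among the leaves. -/
def IsContextTree (D : ℕ) (T : Finset (List 𝒜)) : Prop :=
  (∀ s ∈ T, s.length ≤ D) ∧
  (∀ s ∈ T, ∀ t ∈ T, s <:+ t → s = t) ∧
  (∀ w : List 𝒜, w.length = D → ∃! s, s ∈ T ∧ s <:+ w)

/-- The finset of all context trees of maximum depth `D`. -/
def contextTrees (𝒜 : Type*) [Fintype 𝒜] (D : ℕ) : Finset (Finset (List 𝒜)) :=
  (stringsLe 𝒜 D).powerset.filter (IsContextTree D)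

/-- The branching-process prior `π_D` on context trees. -/
def priorD [Fintype 𝒜] (lam : ℝ) (D : ℕ) (T : Finset (List 𝒜)) : ℝ :=
  (1 - lam) ^ ((T.card - 1) / (Fintype.card 𝒜 - 1)) *
    lam ^ (T.card - (T.filter (fun s => s.length = D)).card)

/-- The window `(x_{1-D}, …, x_{j-1})`. -/
def window (x : ℤ → 𝒜) (D : ℕ) (j : ℕ) : List 𝒜 :=
  (List.range (D + j - 1)).map (fun i => x (1 - (D : ℤ) + (i : ℤ)))

/-- The counting vector `𝐧_{n,s}(a)`. -/
def cnt [DecidableEq 𝒜] (x : ℤ → 𝒜) (D n : ℕ) (s : List 𝒜) (a : 𝒜) : ℕ :=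
  ((Finset.Icc 1 n).filter (fun (j : ℕ) => x (j : ℤ) = a ∧ s <:+ window x D j)).card

/-- The evidence value `P^e(m)` of a counting vector `m` under Dirichlet parameters `α`. -/
def pEv [Fintype 𝒜] (α : 𝒜 → ℝ) (m : 𝒜 → ℕ) : ℝ :=
  (Real.Gamma (∑ a, α a) / Real.Gamma (∑ a, ((m a : ℝ) + α a))) *
    ∏ a, (Real.Gamma ((m a : ℝ) + α a) / Real.Gamma (α a))

/-- The evidence `p^e_{n,s}`. -/
def pE [Fintype 𝒜] [DecidableEq 𝒜] (α : 𝒜 → ℝ) (x : ℤ → 𝒜) (D n : ℕ) (s : List 𝒜) : ℝ :=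
  pEv α (cnt x D n s)

/-- Auxiliary downward recursion for the CTW weighted probabilities, with fuel `k = D - |s|`. -/
def pWaux [Fintype 𝒜] [DecidableEq 𝒜] (α : 𝒜 → ℝ) (lam : ℝ) (x : ℤ → 𝒜) (D n : ℕ) :
    ℕ → List 𝒜 → ℝ
  | 0, s => pE α x D n s
  | k + 1, s => lam * pE α x D n s + (1 - lam) * ∏ q, pWaux α lam x D n k (q :: s)

/-- The CTW weighted probability `p^w_{n,s}`. -/
def pW [Fintype 𝒜] [DecidableEq 𝒜] (α : 𝒜 → ℝ) (lam : ℝ) (x : ℤ → 𝒜) (D n : ℕ)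
    (s : List 𝒜) : ℝ :=
  pWaux α lam x D n (D - s.length) s

/-- The observed suffix `s_{n,l} = (x_{n-l+1}, …, x_n)` of length `l`. -/
def sfx (x : ℤ → 𝒜) (n : ℤ) (l : ℕ) : List 𝒜 :=
  (List.range l).map (fun i => x (n - (l : ℤ) + 1 + (i : ℤ)))

/-- The CTW mixture weight `ω_{n,l}`. -/
def omegaW [Fintype 𝒜] [DecidableEq 𝒜] (α : 𝒜 → ℝ) (lam : ℝ) (x : ℤ → 𝒜) (D n l : ℕ) : ℝ :=
  (∑ T ∈ (contextTrees 𝒜 D).filter (fun T => sfx x n l ∈ T),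
      priorD lam D T * ∏ s ∈ T, pE α x D n s) / pW α lam x D n []

/-- The per-suffix Bayesian predictor `p̄_{n,s}(a)`. -/
def pBar [Fintype 𝒜] [DecidableEq 𝒜] (α : 𝒜 → ℝ) (x : ℤ → 𝒜) (D n : ℕ) (s : List 𝒜)
    (a : 𝒜) : ℝ :=
  (α a + cnt x D n s a) / ∑ q, (α q + cnt x D n s q)

end

section ContextTreeDecomposition

variable {𝒜 : Type*}

theorem concat_suffix_concat_iff {s t : List 𝒜} {a b : 𝒜} :
    s ++ [a] <:+ t ++ [b] ↔ s <:+ t ∧ a = b := by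
  constructor
  · rintro ⟨u, hu⟩
    rw [← List.append_assoc] at hu
    obtain ⟨h₁, h₂⟩ := List.append_inj' hu rfl
    exact ⟨⟨u, h₁⟩, by simpa using h₂⟩
  · rintro ⟨⟨u, rfl⟩, rfl⟩
    exact ⟨u, by simp⟩

theorem concat_injective (q : 𝒜) : Function.Injective (fun t : List 𝒜 => t ++ [q]) :=
  fun _ _ h => List.append_cancel_right h

theorem exists_concat_of_length_eq_succ {w : List 𝒜} {D : ℕ} (hw : w.length = D + 1) :
    ∃ v q, w = v ++ [q] ∧ v.length = D := by
  rcases List.eq_nil_or_concat w with rfl | ⟨v, q, rfl⟩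
  · simp at hw
  · exact ⟨v, q, by simp, by simpa using hw⟩

theorem isContextTree_singleton_nil (D : ℕ) : IsContextTree D ({[]} : Finset (List 𝒜)) := by
  refine ⟨by simp, by simp, fun w _ => ⟨[], by simp, ?_⟩⟩
  simp

theorem IsContextTree.eq_singleton_nil {D : ℕ} {T : Finset (List 𝒜)} (hT : IsContextTree D T)
    (h : [] ∈ T) : T = {[]} := by
  ext s
  rw [Finset.mem_singleton]
  exact ⟨fun hs => (hT.2.1 _ h _ hs List.nil_suffix).symm, fun hs => hs ▸ h⟩

theorem isContextTree_zero_iff {T : Finset (List 𝒜)} : IsContextTree 0 T ↔ T = {[]} := by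
  constructor
  · intro hT
    obtain ⟨s, ⟨hs, hs'⟩, -⟩ := hT.2.2 [] rfl
    exact hT.eq_singleton_nil (List.suffix_nil.1 hs' ▸ hs)
  · rintro rfl
    exact isContextTree_singleton_nil 0

theorem length_sfx (x : ℤ → 𝒜) (n : ℤ) (l : ℕ) : (sfx x n l).length = l := by
  simp [sfx]

theorem sfx_eq_map_range (x : ℤ → 𝒜) (n : ℤ) (l : ℕ) :
    sfx x n l = (List.range l).map (fun i : ℕ => x (n - (l : ℤ) + 1 + (i : ℤ))) := by
  simp [sfx, ← List.map_eq_flatMap, Function.comp_def]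

theorem sfx_eq_drop (x : ℤ → 𝒜) (n : ℤ) {l D : ℕ} (hl : l ≤ D) :
    sfx x n l = (sfx x n D).drop (D - l) := by
  apply List.ext_getElem
  · simp only [length_sfx, List.length_drop]
    omega
  · intro i h₁ h₂
    simp only [sfx_eq_map_range, List.getElem_drop, List.getElem_map, List.getElem_range]
    congr 1
    push_cast [hl]
    ring

/-- Exactly one of the observed suffixes of length at most `D` is a leaf. -/
theorem IsContextTree.card_filter_sfx_mem {D : ℕ} {T : Finset (List 𝒜)}
    (hT : IsContextTree D T) (x : ℤ → 𝒜) (n : ℤ) :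
    ((Finset.range (D + 1)).filter (fun l => sfx x n l ∈ T)).card = 1 := by
  obtain ⟨s, ⟨hs, hsw⟩, huniq⟩ := hT.2.2 (sfx x n D) (length_sfx x n D)
  have hlen : s.length ≤ D := hT.1 s hs
  rw [Finset.card_eq_one]
  refine ⟨s.length, Finset.ext fun l => ?_⟩
  rw [Finset.mem_filter, Finset.mem_range, Finset.mem_singleton]
  constructor
  · rintro ⟨hl, hmem⟩
    rw [← huniq _ ⟨hmem, sfx_eq_drop x n (Nat.lt_succ_iff.1 hl) ▸ List.drop_suffix _ _⟩,
      length_sfx]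
  · rintro rfl
    refine ⟨Nat.lt_succ_iff.2 hlen, ?_⟩
    have hdrop := List.suffix_iff_eq_drop.1 hsw
    rw [length_sfx, ← sfx_eq_drop x n hlen] at hdrop
    rwa [← hdrop]

variable [Fintype 𝒜]

theorem mem_contextTrees {D : ℕ} {T : Finset (List 𝒜)} :
    T ∈ contextTrees 𝒜 D ↔ IsContextTree D T := by
  simp only [contextTrees, stringsLe, Finset.mem_filter, Finset.mem_powerset,
    and_iff_right_iff_imp]
  intro h s hs
  simpa using h.1 s hs

/-- The tree whose subtree at the child `q` of the root is `F q`. -/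
def graft (F : 𝒜 → Finset (List 𝒜)) : Finset (List 𝒜) :=
  (Finset.univ.sigma F).map ⟨fun p : (_ : 𝒜) × List 𝒜 => p.2 ++ [p.1], by
    rintro ⟨a, s⟩ ⟨b, t⟩ h
    obtain ⟨h₁, h₂⟩ := List.append_inj' h rfl
    simp_all⟩

theorem mem_graft {F : 𝒜 → Finset (List 𝒜)} {s : List 𝒜} :
    s ∈ graft F ↔ ∃ q, ∃ t ∈ F q, t ++ [q] = s := by
  simp only [graft, Finset.mem_map, Finset.mem_sigma, Finset.mem_univ, true_and, Sigma.exists]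
  constructor
  · rintro ⟨q, t, ht, h⟩
    exact ⟨q, t, ht, h⟩
  · rintro ⟨q, t, ht, h⟩
    exact ⟨q, t, ht, h⟩

theorem concat_mem_graft {F : 𝒜 → Finset (List 𝒜)} {t : List 𝒜} {q : 𝒜} :
    t ++ [q] ∈ graft F ↔ t ∈ F q := by
  rw [mem_graft]
  constructor
  · rintro ⟨r, u, hu, h⟩
    obtain ⟨h₁, h₂⟩ := List.append_inj' h rfl
    simp_all
  · exact fun h => ⟨q, t, h, rfl⟩

theorem nil_notMem_graft (F : 𝒜 → Finset (List 𝒜)) : [] ∉ graft F := by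
  simp [mem_graft]

theorem graft_injective : Function.Injective (graft : (𝒜 → Finset (List 𝒜)) → _) := by
  intro F G h
  ext q t
  rw [← concat_mem_graft, h, concat_mem_graft]

theorem prod_graft {M : Type*} [CommMonoid M] (F : 𝒜 → Finset (List 𝒜)) (f : List 𝒜 → M) :
    ∏ s ∈ graft F, f s = ∏ q, ∏ t ∈ F q, f (t ++ [q]) := by
  rw [graft, Finset.prod_map, Finset.prod_sigma]
  rfl

theorem sum_graft {M : Type*} [AddCommMonoid M] (F : 𝒜 → Finset (List 𝒜)) (f : List 𝒜 → M) :
    ∑ s ∈ graft F, f s = ∑ q, ∑ t ∈ F q, f (t ++ [q]) := by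
  rw [graft, Finset.sum_map, Finset.sum_sigma]
  rfl

theorem card_graft (F : 𝒜 → Finset (List 𝒜)) : (graft F).card = ∑ q, (F q).card := by
  simp only [Finset.card_eq_sum_ones, sum_graft]

theorem card_filter_graft (F : 𝒜 → Finset (List 𝒜)) (D : ℕ) :
    ((graft F).filter (fun s => s.length = D + 1)).card =
      ∑ q, ((F q).filter (fun s => s.length = D)).card := by
  simp only [Finset.card_filter, sum_graft]
  simp

theorem isContextTree_graft_iff {D : ℕ} {F : 𝒜 → Finset (List 𝒜)} :
    IsContextTree (D + 1) (graft F) ↔ ∀ q, IsContextTree D (F q) := by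
  constructor
  · intro h q
    refine ⟨fun s hs => ?_, fun s hs t ht hst => ?_, fun w hw => ?_⟩
    · simpa using h.1 _ (concat_mem_graft.2 hs)
    · exact concat_injective q (h.2.1 _ (concat_mem_graft.2 hs) _ (concat_mem_graft.2 ht)
        (concat_suffix_concat_iff.2 ⟨hst, rfl⟩))
    · obtain ⟨s, ⟨hs, hsw⟩, huniq⟩ := h.2.2 (w ++ [q]) (by simp [hw])
      obtain ⟨r, t, ht, rfl⟩ := mem_graft.1 hs
      obtain ⟨htw, rfl⟩ := concat_suffix_concat_iff.1 hsw
      exact ⟨t, ⟨ht, htw⟩, fun u hu => concat_injective r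
        (huniq _ ⟨concat_mem_graft.2 hu.1, concat_suffix_concat_iff.2 ⟨hu.2, rfl⟩⟩)⟩
  · intro h
    refine ⟨fun s hs => ?_, fun s hs t ht hst => ?_, fun w hw => ?_⟩
    · obtain ⟨q, u, hu, rfl⟩ := mem_graft.1 hs
      simpa using (h q).1 u hu
    · obtain ⟨q, u, hu, rfl⟩ := mem_graft.1 hs
      obtain ⟨r, v, hv, rfl⟩ := mem_graft.1 ht
      obtain ⟨huv, rfl⟩ := concat_suffix_concat_iff.1 hst
      rw [(h q).2.1 u hu v hv huv]
    · obtain ⟨v, q, rfl, hv⟩ := exists_concat_of_length_eq_succ hw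
      obtain ⟨t, ⟨ht, htv⟩, huniq⟩ := (h q).2.2 v hv
      refine ⟨t ++ [q], ⟨concat_mem_graft.2 ht, concat_suffix_concat_iff.2 ⟨htv, rfl⟩⟩, ?_⟩
      rintro s ⟨hs, hsv⟩
      obtain ⟨r, u, hu, rfl⟩ := mem_graft.1 hs
      obtain ⟨huv, rfl⟩ := concat_suffix_concat_iff.1 hsv
      rw [huniq u ⟨hu, huv⟩]

theorem exists_graft_eq {T : Finset (List 𝒜)} (h : [] ∉ T) : ∃ F, graft F = T := by
  refine ⟨fun q => T.preimage (fun t => t ++ [q]) (concat_injective q).injOn, ?_⟩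
  ext s
  rcases List.eq_nil_or_concat s with rfl | ⟨v, q, rfl⟩
  · simp [h, nil_notMem_graft]
  · rw [List.concat_eq_append, concat_mem_graft, Finset.mem_preimage]

theorem contextTrees_zero : contextTrees 𝒜 0 = {{[]}} := by
  ext T
  rw [mem_contextTrees, isContextTree_zero_iff, Finset.mem_singleton]

theorem sum_contextTrees_succ [DecidableEq 𝒜] {M : Type*} [AddCommMonoid M] (D : ℕ)
    (g : Finset (List 𝒜) → M) :
    ∑ T ∈ contextTrees 𝒜 (D + 1), g T =
      g {[]} + ∑ F ∈ Fintype.piFinset (fun _ : 𝒜 => contextTrees 𝒜 D), g (graft F) := by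
  have hset : contextTrees 𝒜 (D + 1) =
      insert {[]} ((Fintype.piFinset (fun _ : 𝒜 => contextTrees 𝒜 D)).map
        ⟨graft, graft_injective⟩) := by
    ext T
    simp only [Finset.mem_insert, Finset.mem_map, Fintype.mem_piFinset, mem_contextTrees,
      Function.Embedding.coeFn_mk]
    constructor
    · intro hT
      by_cases h : [] ∈ T
      · exact Or.inl (hT.eq_singleton_nil h)
      · obtain ⟨F, rfl⟩ := exists_graft_eq h
        exact Or.inr ⟨F, isContextTree_graft_iff.1 hT, rfl⟩
    · rintro (rfl | ⟨F, hF, rfl⟩)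
      · exact isContextTree_singleton_nil _
      · exact isContextTree_graft_iff.2 hF
  rw [hset, Finset.sum_insert, Finset.sum_map]
  · rfl
  · simp only [Finset.mem_map, Function.Embedding.coeFn_mk, not_exists, not_and]
    exact fun F _ h => nil_notMem_graft F (h ▸ Finset.mem_singleton_self _)

/-- A full `A`-ary tree with `m` internal nodes has `m * (A - 1) + 1` leaves. -/
theorem IsContextTree.exists_card_eq (hA : 1 ≤ Fintype.card 𝒜) {D : ℕ} {T : Finset (List 𝒜)}
    (hT : IsContextTree D T) : ∃ m, T.card = m * (Fintype.card 𝒜 - 1) + 1 := by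
  induction D generalizing T with
  | zero => exact ⟨0, by simp [isContextTree_zero_iff.1 hT]⟩
  | succ D ih =>
    by_cases h : [] ∈ T
    · exact ⟨0, by simp [hT.eq_singleton_nil h]⟩
    · obtain ⟨F, rfl⟩ := exists_graft_eq h
      choose m hm using fun q => ih (isContextTree_graft_iff.1 hT q)
      refine ⟨∑ q, m q + 1, ?_⟩
      simp only [card_graft, hm, Finset.sum_add_distrib, ← Finset.sum_mul, Finset.sum_const,
        Finset.card_univ, smul_eq_mul, mul_one, add_mul, one_mul]
      omega

theorem priorD_graft (hA : 2 ≤ Fintype.card 𝒜) (lam : ℝ) {D : ℕ} {F : 𝒜 → Finset (List 𝒜)}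
    (hF : ∀ q, IsContextTree D (F q)) :
    priorD lam (D + 1) (graft F) = (1 - lam) * ∏ q, priorD lam D (F q) := by
  choose m hm using fun q => (hF q).exists_card_eq (by omega)
  have hpos : 0 < Fintype.card 𝒜 - 1 := by omega
  have hcard : (graft F).card = (∑ q, m q + 1) * (Fintype.card 𝒜 - 1) + 1 := by
    simp only [card_graft, hm, Finset.sum_add_distrib, ← Finset.sum_mul, Finset.sum_const,
      Finset.card_univ, smul_eq_mul, mul_one, add_mul, one_mul]
    omega
  have hleaves : (graft F).card - ((graft F).filter (fun s => s.length = D + 1)).card =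
      ∑ q, ((F q).card - ((F q).filter (fun s => s.length = D)).card) := by
    rw [card_filter_graft, card_graft, Finset.sum_tsub_distrib]
    exact fun q _ => Finset.card_filter_le _ _
  have hdiv : ∀ q, ((F q).card - 1) / (Fintype.card 𝒜 - 1) = m q := fun q => by
    rw [hm, Nat.add_sub_cancel, Nat.mul_div_cancel _ hpos]
  simp only [priorD, hleaves, hdiv]
  rw [hcard, Nat.add_sub_cancel, Nat.mul_div_cancel _ hpos, Finset.prod_mul_distrib,
    Finset.prod_pow_eq_pow_sum, Finset.prod_pow_eq_pow_sum, pow_succ]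
  ring

/-- The prior mixture of leaf products over all context trees, evaluated at the node `s`, obeys
the recursion of the weighted probabilities. -/
theorem sum_priorD_mul_prod_pE [DecidableEq 𝒜] (hA : 2 ≤ Fintype.card 𝒜) (α : 𝒜 → ℝ)
    (lam : ℝ) (x : ℤ → 𝒜) (D n k : ℕ) (s : List 𝒜) :
    ∑ T ∈ contextTrees 𝒜 k, priorD lam k T * ∏ t ∈ T, pE α x D n (t ++ s) =
      pWaux α lam x D n k s := by
  induction k generalizing s with
  | zero => simp [contextTrees_zero, priorD, pWaux, Finset.filter_singleton]
  | succ k ih =>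
    rw [sum_contextTrees_succ, pWaux]
    congr 1
    · simp [priorD, Finset.filter_singleton]
    · simp only [← ih]
      rw [Finset.prod_univ_sum, Finset.mul_sum]
      refine Finset.sum_congr rfl fun F hF => ?_
      rw [priorD_graft hA lam fun q => mem_contextTrees.1 (Fintype.mem_piFinset.1 hF q),
        prod_graft, Finset.prod_mul_distrib, mul_assoc]
      simp

theorem isContextTree_filter_length_eq {D l : ℕ} (hl : l ≤ D) :
    IsContextTree D ((stringsLe 𝒜 D).filter (fun s => s.length = l)) := by
  have hmem : ∀ s, s ∈ (stringsLe 𝒜 D).filter (fun s => s.length = l) ↔ s.length = l := by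
    intro s
    simp only [stringsLe, Finset.mem_filter, Set.Finite.mem_toFinset, Set.mem_ofPred_eq]
    omega
  refine ⟨fun s hs => ?_, fun s hs t ht hst => ?_, fun w hw => ?_⟩
  · exact ((hmem s).1 hs).trans_le hl
  · exact hst.eq_of_length (((hmem s).1 hs).trans ((hmem t).1 ht).symm)
  · refine ⟨w.drop (D - l), ⟨(hmem _).2 (by simp [hw]; omega), List.drop_suffix _ _⟩, ?_⟩
    rintro s ⟨hs, hsw⟩
    rw [List.suffix_iff_eq_drop.1 hsw, hw, (hmem s).1 hs]

theorem pE_pos [DecidableEq 𝒜] [Nonempty 𝒜] {α : 𝒜 → ℝ} (hα : ∀ a, 0 < α a) (x : ℤ → 𝒜)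
    (D n : ℕ) (s : List 𝒜) : 0 < pE α x D n s := by
  have h : ∀ a, 0 < (cnt x D n s a : ℝ) + α a :=
    fun a => add_pos_of_nonneg_of_pos (Nat.cast_nonneg _) (hα a)
  refine mul_pos (div_pos (Real.Gamma_pos_of_pos ?_) (Real.Gamma_pos_of_pos ?_))
    (Finset.prod_pos fun a _ =>
      div_pos (Real.Gamma_pos_of_pos (h a)) (Real.Gamma_pos_of_pos (hα a)))
  · exact Finset.sum_pos (fun a _ => hα a) Finset.univ_nonempty
  · exact Finset.sum_pos (fun a _ => h a) Finset.univ_nonempty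

theorem pWaux_pos [DecidableEq 𝒜] [Nonempty 𝒜] {α : 𝒜 → ℝ} (hα : ∀ a, 0 < α a) {lam : ℝ}
    (hlam : lam ∈ Set.Ioo (0 : ℝ) 1) (x : ℤ → 𝒜) (D n k : ℕ) (s : List 𝒜) :
    0 < pWaux α lam x D n k s := by
  induction k generalizing s with
  | zero => exact pE_pos hα x D n s
  | succ k ih =>
    exact add_pos (mul_pos hlam.1 (pE_pos hα x D n s))
      (mul_pos (sub_pos.2 hlam.2) (Finset.prod_pos fun q _ => ih (q :: s)))

theorem priorD_pos {lam : ℝ} (hlam : lam ∈ Set.Ioo (0 : ℝ) 1) (D : ℕ) (T : Finset (List 𝒜)) :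
    0 < priorD lam D T :=
  mul_pos (pow_pos (sub_pos.2 hlam.2) _) (pow_pos hlam.1 _)

end ContextTreeDecomposition

/-- The CTW mixture weights form a probability vector: each `ω_{n,l}` is
positive and they sum to one. -/
theorem omega_prob_vector {𝒜 : Type*} [Fintype 𝒜] [DecidableEq 𝒜]
    (hA : 2 ≤ Fintype.card 𝒜) (D n : ℕ) (hD : 1 ≤ D) (hn : 1 ≤ n)
    (lam : ℝ) (hlam : lam ∈ Set.Ioo (0 : ℝ) 1)
    (α : 𝒜 → ℝ) (hα : ∀ a, 0 < α a) (x : ℤ → 𝒜) :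
    (∀ l ≤ D, 0 < omegaW α lam x D n l) ∧
      ∑ l ∈ Finset.range (D + 1), omegaW α lam x D n l = 1 := by
  have : Nonempty 𝒜 := Fintype.card_pos_iff.1 (by omega)
  have hW : 0 < pW α lam x D n [] := pWaux_pos hα hlam x D n _ []
  constructor
  · intro l hl
    refine div_pos (Finset.sum_pos (fun T _ => mul_pos (priorD_pos hlam D T)
      (Finset.prod_pos fun s _ => pE_pos hα x D n s)) ?_) hW
    refine ⟨(stringsLe 𝒜 D).filter (fun s => s.length = l), Finset.mem_filter.2
      ⟨mem_contextTrees.2 (isContextTree_filter_length_eq hl), ?_⟩⟩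
    simp [stringsLe, length_sfx, hl]
  · have hsum : ∑ T ∈ contextTrees 𝒜 D, priorD lam D T * ∏ s ∈ T, pE α x D n s =
        pW α lam x D n [] := by
      simpa [pW] using sum_priorD_mul_prod_pE hA α lam x D n D []
    simp only [omegaW]
    rw [← Finset.sum_div, div_eq_one_iff_eq hW.ne', ← hsum]
    simp only [Finset.sum_filter]
    rw [Finset.sum_comm]
    refine Finset.sum_congr rfl fun T hT => ?_
    rw [← Finset.sum_filter, Finset.sum_const]
    convert one_smul ℕ _
    convert (mem_contextTrees.1 hT).card_filter_sfx_mem x n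
end

section
/- The value p^w_{n,()} computed at the root by the CTW recursion equals the Bayesian mixture of per-tree marginal likelihoods under the CTW prior: p^w_{n,()} = Σ_{T ∈ 𝒯(D)} π_D(T) · Π_{s ∈ ℒ(T)} p^e_{n,s}. -/
open scoped Classical

namespace ContextTree

variable {𝒜 : Type*}

theorem concat_suffix_concat {s t : List 𝒜} (h : s <:+ t) (q : 𝒜) : s ++ [q] <:+ t ++ [q] := by
  obtain ⟨l, rfl⟩ := h
  exact ⟨l, (List.append_assoc ..).symm⟩

/-- The subtree of `T` consisting of the contexts whose most recent symbol is `q`. -/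
noncomputable def child (T : Finset (List 𝒜)) (q : 𝒜) : Finset (List 𝒜) :=
  T.preimage (fun t => t ++ [q]) (List.append_left_injective [q]).injOn

theorem mem_child {T : Finset (List 𝒜)} {q : 𝒜} {t : List 𝒜} :
    t ∈ child T q ↔ t ++ [q] ∈ T := by
  simp [child]

theorem mem_contextTrees [Fintype 𝒜] {D : ℕ} {T : Finset (List 𝒜)} :
    T ∈ contextTrees 𝒜 D ↔ IsContextTree D T := by
  simp only [contextTrees, stringsLe, Finset.mem_filter, Finset.mem_powerset, and_iff_right_iff_imp]
  intro h s hs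
  simpa using h.1 s hs

theorem isContextTree_singleton_nil (D : ℕ) : IsContextTree D {([] : List 𝒜)} := by
  refine ⟨by simp, by simp, fun w _ => ⟨[], by simp, by simp⟩⟩

theorem eq_singleton_nil_of_nil_mem {D : ℕ} {T : Finset (List 𝒜)} (hT : IsContextTree D T)
    (h : [] ∈ T) : T = {[]} := by
  refine Finset.eq_singleton_iff_unique_mem.2 ⟨h, fun t ht => ?_⟩
  exact (hT.2.1 [] h t ht List.nil_suffix).symm

theorem contextTrees_zero [Fintype 𝒜] : contextTrees 𝒜 0 = {{[]}} := by
  ext T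
  rw [mem_contextTrees, Finset.mem_singleton]
  refine ⟨fun hT => ?_, fun h => h ▸ isContextTree_singleton_nil 0⟩
  obtain ⟨s, ⟨hs, hs'⟩, -⟩ := hT.2.2 [] rfl
  rw [List.suffix_nil] at hs'
  exact eq_singleton_nil_of_nil_mem hT (hs' ▸ hs)

theorem isContextTree_child {D : ℕ} {T : Finset (List 𝒜)} (hT : IsContextTree (D + 1) T)
    (h : [] ∉ T) (q : 𝒜) : IsContextTree D (child T q) := by
  refine ⟨fun s hs => ?_, fun s hs t ht hst => ?_, fun w hw => ?_⟩
  · simpa using hT.1 _ (mem_child.1 hs)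
  · simpa using hT.2.1 _ (mem_child.1 hs) _ (mem_child.1 ht) (concat_suffix_concat hst q)
  · obtain ⟨s, ⟨hs, hsw⟩, hu⟩ := hT.2.2 (w ++ [q]) (by simp [hw])
    rcases List.suffix_concat_iff.1 hsw with rfl | ⟨t, rfl, htw⟩
    · exact absurd hs h
    · refine ⟨t, ⟨mem_child.2 hs, htw⟩, fun r hr => ?_⟩
      simpa using hu (r ++ [q]) ⟨mem_child.1 hr.1, concat_suffix_concat hr.2 q⟩

theorem card_sub_card_filter (D : ℕ) (T : Finset (List 𝒜)) :
    T.card - (T.filter fun s => s.length = D).card = ∑ s ∈ T, if s.length = D then 0 else 1 := by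
  rw [Finset.card_filter, Finset.card_eq_sum_ones, Nat.sub_eq_iff_eq_add,
    ← Finset.sum_add_distrib]
  · exact Finset.sum_congr rfl fun s _ => by split_ifs <;> rfl
  · exact Finset.sum_le_sum fun s _ => by split_ifs <;> simp

/-- The tree whose root has the trees `P q` as subtrees. -/
noncomputable def graft [Fintype 𝒜] (P : 𝒜 → Finset (List 𝒜)) : Finset (List 𝒜) :=
  Finset.univ.biUnion fun q => (P q).map ⟨fun t => t ++ [q], List.append_left_injective [q]⟩

variable [Fintype 𝒜]

theorem mem_graft {P : 𝒜 → Finset (List 𝒜)} {s : List 𝒜} :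
    s ∈ graft P ↔ ∃ q, ∃ t ∈ P q, t ++ [q] = s := by
  simp [graft]

theorem nil_notMem_graft (P : 𝒜 → Finset (List 𝒜)) : [] ∉ graft P := by
  simp [mem_graft]

theorem concat_mem_graft {P : 𝒜 → Finset (List 𝒜)} {q : 𝒜} {t : List 𝒜} :
    t ++ [q] ∈ graft P ↔ t ∈ P q := by
  rw [mem_graft]
  constructor
  · rintro ⟨r, u, hu, h⟩
    obtain ⟨rfl, rfl⟩ := List.append_singleton_inj.1 h
    exact hu
  · exact fun h => ⟨q, t, h, rfl⟩

theorem child_graft (P : 𝒜 → Finset (List 𝒜)) : child (graft P) = P := by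
  ext q t
  rw [mem_child, concat_mem_graft]

theorem graft_child {T : Finset (List 𝒜)} (h : [] ∉ T) : graft (child T) = T := by
  ext s
  rcases List.eq_nil_or_concat' s with rfl | ⟨t, q, rfl⟩
  · simp [h, nil_notMem_graft]
  · rw [concat_mem_graft, mem_child]

theorem isContextTree_graft {D : ℕ} {P : 𝒜 → Finset (List 𝒜)}
    (hP : ∀ q, IsContextTree D (P q)) : IsContextTree (D + 1) (graft P) := by
  refine ⟨fun s hs => ?_, fun s hs t ht hst => ?_, fun w hw => ?_⟩
  · obtain ⟨q, t, ht, rfl⟩ := mem_graft.1 hs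
    simpa using (hP q).1 t ht
  · obtain ⟨q, u, hu, rfl⟩ := mem_graft.1 hs
    obtain ⟨r, v, hv, rfl⟩ := mem_graft.1 ht
    rcases List.suffix_concat_iff.1 hst with h | ⟨y, h, hy⟩
    · simp at h
    · obtain ⟨rfl, rfl⟩ := List.append_singleton_inj.1 h
      rw [(hP q).2.1 u hu v hv hy]
  · rcases List.eq_nil_or_concat' w with rfl | ⟨v, q, rfl⟩
    · simp at hw
    · obtain ⟨s, ⟨hs, hsv⟩, hu⟩ := (hP q).2.2 v (by simpa using hw)
      refine ⟨s ++ [q], ⟨concat_mem_graft.2 hs, concat_suffix_concat hsv q⟩, ?_⟩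
      rintro r ⟨hr, hrv⟩
      rcases List.suffix_concat_iff.1 hrv with rfl | ⟨y, rfl, hy⟩
      · exact absurd hr (nil_notMem_graft P)
      · rw [hu y ⟨concat_mem_graft.1 hr, hy⟩]

/-- A context tree of positive depth is the root alone or a graft of context trees. -/
theorem sum_contextTrees_succ [DecidableEq 𝒜] (D : ℕ) (F : Finset (List 𝒜) → ℝ) :
    ∑ T ∈ contextTrees 𝒜 (D + 1), F T =
      F {[]} + ∑ P ∈ Fintype.piFinset fun _ : 𝒜 => contextTrees 𝒜 D, F (graft P) := by
  rw [← Finset.add_sum_erase _ _ (mem_contextTrees.2 (isContextTree_singleton_nil (D + 1)))]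
  congr 1
  have key : ∀ T ∈ (contextTrees 𝒜 (D + 1)).erase {[]}, IsContextTree (D + 1) T ∧ [] ∉ T := by
    intro T hT
    rw [Finset.mem_erase, mem_contextTrees] at hT
    exact ⟨hT.2, fun h => hT.1 (eq_singleton_nil_of_nil_mem hT.2 h)⟩
  refine Finset.sum_nbij' child graft (fun T hT => ?_) (fun P hP => ?_)
    (fun T hT => graft_child (key T hT).2) (fun P _ => child_graft P)
    (fun T hT => by rw [graft_child (key T hT).2])
  · exact Fintype.mem_piFinset.2 fun q =>
      mem_contextTrees.2 (isContextTree_child (key T hT).1 (key T hT).2 q)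
  · refine Finset.mem_erase.2 ⟨fun h => nil_notMem_graft P (h ▸ Finset.mem_singleton_self _), ?_⟩
    exact mem_contextTrees.2
      (isContextTree_graft fun q => mem_contextTrees.1 (Fintype.mem_piFinset.1 hP q))

@[to_additive]
theorem prod_graft {M : Type*} [CommMonoid M] (P : 𝒜 → Finset (List 𝒜)) (g : List 𝒜 → M) :
    ∏ s ∈ graft P, g s = ∏ q, ∏ t ∈ P q, g (t ++ [q]) := by
  rw [graft, Finset.prod_biUnion]
  · simp
  · intro q _ r _ hqr
    simp only [Function.onFun, Finset.disjoint_left, Finset.mem_map, Function.Embedding.coeFn_mk]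
    rintro _ ⟨t, -, rfl⟩ ⟨u, -, h⟩
    exact hqr (List.append_singleton_inj.1 h).2.symm

theorem card_graft (P : 𝒜 → Finset (List 𝒜)) : (graft P).card = ∑ q, (P q).card := by
  simp only [Finset.card_eq_sum_ones, sum_graft]

/-- A full tree with `m` internal nodes has `1 + m * (|𝒜| - 1)` leaves. -/
theorem exists_card_eq (hA : 1 ≤ Fintype.card 𝒜) {D : ℕ} {T : Finset (List 𝒜)}
    (hT : IsContextTree D T) : ∃ m, T.card = 1 + m * (Fintype.card 𝒜 - 1) := by
  induction D generalizing T with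
  | zero =>
    rw [← mem_contextTrees, contextTrees_zero, Finset.mem_singleton] at hT
    exact ⟨0, by simp [hT]⟩
  | succ D ih =>
    by_cases h : [] ∈ T
    · exact ⟨0, by simp [eq_singleton_nil_of_nil_mem hT h]⟩
    · choose m hm using fun q => ih (isContextTree_child hT h q)
      refine ⟨1 + ∑ q, m q, ?_⟩
      rw [← graft_child h, card_graft]
      simp only [hm, Finset.sum_add_distrib, ← Finset.sum_mul, Finset.sum_const, Finset.card_univ,
        smul_eq_mul, mul_one, add_mul, one_mul]
      omega

theorem priorD_graft (hA : 2 ≤ Fintype.card 𝒜) (lam : ℝ) {D : ℕ} {P : 𝒜 → Finset (List 𝒜)}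
    (hP : ∀ q, IsContextTree D (P q)) :
    priorD lam (D + 1) (graft P) = (1 - lam) * ∏ q, priorD lam D (P q) := by
  choose m hm using fun q => exists_card_eq (by omega) (hP q)
  have hpos : 0 < Fintype.card 𝒜 - 1 := by omega
  have hcard : (graft P).card - 1 = (1 + ∑ q, m q) * (Fintype.card 𝒜 - 1) := by
    rw [card_graft]
    simp only [hm, Finset.sum_add_distrib, ← Finset.sum_mul, Finset.sum_const, Finset.card_univ,
      smul_eq_mul, mul_one, add_mul, one_mul]
    omega
  simp only [priorD, card_sub_card_filter]
  simp only [hcard, sum_graft, hm, Nat.add_sub_cancel_left,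
    Nat.mul_div_cancel _ hpos, Finset.prod_mul_distrib, Finset.prod_pow_eq_pow_sum, pow_add,
    pow_one, List.length_append, List.length_singleton, Nat.add_right_cancel_iff, mul_assoc]

theorem pWaux_eq_sum [DecidableEq 𝒜] (hA : 2 ≤ Fintype.card 𝒜) (lam : ℝ) (α : 𝒜 → ℝ)
    (x : ℤ → 𝒜) (D n k : ℕ) (s : List 𝒜) :
    pWaux α lam x D n k s =
      ∑ T ∈ contextTrees 𝒜 k, priorD lam k T * ∏ t ∈ T, pE α x D n (t ++ s) := by
  induction k generalizing s with
  | zero => simp [contextTrees_zero, priorD, pWaux, Finset.filter_singleton]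
  | succ k ih =>
    rw [sum_contextTrees_succ, pWaux]
    congr 1
    · simp [priorD, Finset.filter_singleton]
    · simp only [ih, Finset.prod_univ_sum, Finset.mul_sum]
      refine Finset.sum_congr rfl fun P hP => ?_
      rw [priorD_graft hA lam fun q => mem_contextTrees.1 (Fintype.mem_piFinset.1 hP q),
        prod_graft, Finset.prod_mul_distrib, mul_assoc]
      simp

end ContextTree

/-- The root CTW weighted probability equals the Bayesian mixture of per-tree
marginal likelihoods under the branching-process prior. -/
theorem ctw_root_is_bayes_mixture {𝒜 : Type*} [Fintype 𝒜] [DecidableEq 𝒜]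
    (hA : 2 ≤ Fintype.card 𝒜) (D n : ℕ) (hD : 1 ≤ D) (hn : 1 ≤ n)
    (lam : ℝ) (hlam : lam ∈ Set.Ioo (0 : ℝ) 1)
    (α : 𝒜 → ℝ) (hα : ∀ a, 0 < α a) (x : ℤ → 𝒜) :
    pW α lam x D n [] =
      ∑ T ∈ contextTrees 𝒜 D, priorD lam D T * ∏ s ∈ T, pE α x D n s := by
  simpa [pW] using ContextTree.pWaux_eq_sum hA lam α x D n D []
end
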